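/- arXiv:2106.06120 — 3 statements merged into one kernel-verified Lean document; each statement's English description precedes it below -/
import Mathlib

section
/- Let n ≥ 1 and let ũ be a real-valued function defined and harmonic on the open upper half-space ℝ^{n+1}_+. If there exist constants C > 0 and c > 0 such that |ũ(x)| ≤ C e^{−c|x|} for all x ∈ ℝ^{n+1}_+, then ũ(x) = 0 for all x ∈ ℝ^{n+1}_+. -/
open MeasureTheory

/-- The (coordinate-wise) Laplacian of `f : ℝ^m → ℝ` at `x`:
`∑ i, ∂²f/∂xᵢ²` computed via iterated Fréchet derivatives in coordinate directions. -/
noncomputable def lapl {m : ℕ} (f : EuclideanSpace ℝ (Fin m) → ℝ)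
    (x : EuclideanSpace ℝ (Fin m)) : ℝ :=
  ∑ i : Fin m, fderiv ℝ (fun y => fderiv ℝ f y (EuclideanSpace.single i 1)) x
    (EuclideanSpace.single i 1)

/-- `f` is harmonic on the (open) set `U`: it is `C²` on `U` and its Laplacian vanishes on `U`. -/
def HarmonicOnSet {m : ℕ} (f : EuclideanSpace ℝ (Fin m) → ℝ)
    (U : Set (EuclideanSpace ℝ (Fin m))) : Prop :=
  ContDiffOn ℝ 2 f U ∧ ∀ x ∈ U, lapl f x = 0

/-- The south pole `s = (0, …, 0, -1)` of the unit sphere in `ℝ^{n+1}`. -/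
noncomputable def southPole (n : ℕ) : EuclideanSpace ℝ (Fin (n+1)) :=
  -(EuclideanSpace.single (Fin.last n) 1)

/-- The map `Φ(z) = 2 (z - s)/‖z - s‖² + s`. -/
noncomputable def Phi {n : ℕ} (z : EuclideanSpace ℝ (Fin (n+1))) :
    EuclideanSpace ℝ (Fin (n+1)) :=
  (2 / ‖z - southPole n‖ ^ 2) • (z - southPole n) + southPole n

/-- The Kelvin transform `K[w](z) = 2^{(n-1)/2} ‖z - s‖^{1-n} w(Φ(z))`. -/
noncomputable def kelvin {n : ℕ} (w : EuclideanSpace ℝ (Fin (n+1)) → ℝ)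
    (z : EuclideanSpace ℝ (Fin (n+1))) : ℝ :=
  2 ^ (((n : ℝ) - 1) / 2) * ‖z - southPole n‖ ^ ((1 : ℝ) - n) * w (Phi z)

/-- Embed `ℝⁿ` into `ℝ^{n+1}` as the hyperplane `x_{n+1} = 0`. -/
noncomputable def emb {n : ℕ} (x' : EuclideanSpace ℝ (Fin n)) :
    EuclideanSpace ℝ (Fin (n+1)) :=
  (WithLp.equiv 2 (Fin (n+1) → ℝ)).symm
    (Fin.snoc ((WithLp.equiv 2 (Fin n → ℝ)) x') 0)

/-- The point `(x', t) ∈ ℝ^{n+1}` for `x' ∈ ℝⁿ` and `t ∈ ℝ`. -/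
noncomputable def embt {n : ℕ} (x' : EuclideanSpace ℝ (Fin n)) (t : ℝ) :
    EuclideanSpace ℝ (Fin (n+1)) :=
  (WithLp.equiv 2 (Fin (n+1) → ℝ)).symm
    (Fin.snoc ((WithLp.equiv 2 (Fin n → ℝ)) x') t)

/-- The `Lᵖ` norm `(∫_S |f|ᵖ)^{1/p}` of `f` over a set `S` (w.r.t. Lebesgue measure). -/
noncomputable def LpnormOn {m : ℕ} (f : EuclideanSpace ℝ (Fin m) → ℝ) (p : ℝ)
    (S : Set (EuclideanSpace ℝ (Fin m))) : ℝ :=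
  (∫⁻ x in S, ENNReal.ofReal (|f x| ^ p)).toReal ^ (1 / p)

/-- The half ball `B⁺_R(x₀) = {x ∈ ℝ^{n+1} : x_{n+1} > 0, |x - x₀| ≤ R}`. -/
def Bplus {n : ℕ} (x0 : EuclideanSpace ℝ (Fin (n+1))) (R : ℝ) :
    Set (EuclideanSpace ℝ (Fin (n+1))) :=
  {x | 0 < x (Fin.last n) ∧ dist x x0 ≤ R}

/-- The boundary ball `B'_R(x₀) = {x' ∈ ℝⁿ : |(x', 0) - x₀| ≤ R}`. -/
def Bprime {n : ℕ} (x0 : EuclideanSpace ℝ (Fin (n+1))) (R : ℝ) :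
    Set (EuclideanSpace ℝ (Fin n)) :=
  {x' | dist (emb x') x0 ≤ R}

open Filter Topology

theorem one_add_le_exp {γ : ℝ} (hγ : 0 < γ) (r : ℝ) (hr : 0 ≤ r) :
    1 + r ≤ (1 + 1 / γ) * Real.exp (γ * r) := by
  have h1 : 1 ≤ Real.exp (γ * r) := Real.one_le_exp (by positivity)
  have h2 : r ≤ 1 / γ * Real.exp (γ * r) := by
    have := Real.add_one_le_exp (γ * r)
    rw [div_mul_eq_mul_div, le_div_iff₀ hγ]
    linarith
  linarith

theorem integrable_exp_neg_mul_norm {m : ℕ} {γ : ℝ} (hγ : 0 < γ) :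
    Integrable (fun x : EuclideanSpace ℝ (Fin m) => Real.exp (-γ * ‖x‖)) := by
  have hd : (0 : ℝ) < m + 1 := by positivity
  have hint := (integrable_one_add_norm (E := EuclideanSpace ℝ (Fin m)) (μ := volume)
    (r := (m : ℝ) + 1) (by simp)).const_mul ((1 + 1 / (γ / (m + 1))) ^ ((m : ℝ) + 1))
  refine hint.mono' (by fun_prop) (ae_of_all _ fun x => ?_)
  have h := one_add_le_exp (div_pos hγ hd) ‖x‖ (norm_nonneg x)
  have h0 : 0 < 1 + ‖x‖ := by positivity
  have hp := Real.rpow_le_rpow h0.le h hd.le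
  rw [Real.mul_rpow (by positivity) (by positivity), ← Real.exp_mul,
    show γ / (m + 1) * ‖x‖ * ((m : ℝ) + 1) = γ * ‖x‖ by field_simp] at hp
  rw [Real.norm_of_nonneg (Real.exp_pos _).le, Real.rpow_neg h0.le, neg_mul, Real.exp_neg,
    ← div_eq_mul_inv, le_div_iff₀ (by positivity), inv_mul_le_iff₀ (by positivity), mul_comm]
  exact hp

section Green

variable {m : ℕ}

local notation "E" => EuclideanSpace ℝ (Fin m)

theorem fderiv_mul_apply {f g : E → ℝ} (hf : Differentiable ℝ f) (hg : Differentiable ℝ g)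
    (v x : E) :
    fderiv ℝ (fun y => f y * g y) x v = f x * fderiv ℝ g x v + g x * fderiv ℝ f x v := by
  rw [fderiv_fun_mul (hf x) (hg x)]
  simp

theorem fderiv_fderiv_mul_apply {f g : E → ℝ} (hf : ContDiff ℝ 2 f) (hg : ContDiff ℝ 2 g)
    (v x : E) :
    fderiv ℝ (fun y => fderiv ℝ (fun y => f y * g y) y v) x v =
      f x * fderiv ℝ (fun y => fderiv ℝ g y v) x v + 2 * (fderiv ℝ f x v * fderiv ℝ g x v)
        + g x * fderiv ℝ (fun y => fderiv ℝ f y v) x v := by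
  have hf1 := hf.differentiable two_ne_zero
  have hg1 := hg.differentiable two_ne_zero
  have hf2 : Differentiable ℝ (fun y => fderiv ℝ f y v) :=
    ((hf.fderiv_right (m := 1) le_rfl).clm_apply contDiff_const).differentiable one_ne_zero
  have hg2 : Differentiable ℝ (fun y => fderiv ℝ g y v) :=
    ((hg.fderiv_right (m := 1) le_rfl).clm_apply contDiff_const).differentiable one_ne_zero
  simp_rw [fderiv_mul_apply hf1 hg1]
  rw [fderiv_fun_add (by fun_prop) (by fun_prop),
    add_apply, fderiv_mul_apply hf1 hg2, fderiv_mul_apply hg1 hf2]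
  ring

theorem lapl_mul {f g : E → ℝ} (hf : ContDiff ℝ 2 f) (hg : ContDiff ℝ 2 g) (x : E) :
    lapl (fun y => f y * g y) x = f x * lapl g x
      + 2 * ∑ i, fderiv ℝ f x (EuclideanSpace.single i 1) *
          fderiv ℝ g x (EuclideanSpace.single i 1)
      + g x * lapl f x := by
  simp only [lapl, fderiv_fderiv_mul_apply hf hg, Finset.sum_add_distrib, Finset.mul_sum]

theorem fderiv_comp_smul_apply (f : E → ℝ) (r : ℝ) (v x : E) :
    fderiv ℝ (fun y => f (r • y)) x v = r * fderiv ℝ f (r • x) v := by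
  rw [fderiv_comp_smul]
  simp

theorem lapl_comp_smul (f : E → ℝ) (r : ℝ) (x : E) :
    lapl (fun y => f (r • y)) x = r ^ 2 * lapl f (r • x) := by
  simp only [lapl, fderiv_comp_smul_apply, Finset.mul_sum]
  refine Finset.sum_congr rfl fun i _ => ?_
  have h := fderiv_const_smul_field (𝕜 := ℝ) r
    (f := fun y => fderiv ℝ f (r • y) (EuclideanSpace.single i 1))
  refine (congrArg (fun L => L x (EuclideanSpace.single i 1)) h).trans ?_
  rw [Pi.smul_apply, smul_apply, smul_eq_mul,
    fderiv_comp_smul_apply (fun y => fderiv ℝ f y (EuclideanSpace.single i 1))]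
  ring

theorem ContDiff.continuous_fderiv_fderiv {f : E → ℝ} (hf : ContDiff ℝ 2 f) (v : E) :
    Continuous (fun x => fderiv ℝ (fun y => fderiv ℝ f y v) x v) := by
  have h : ContDiff ℝ 1 (fun y => fderiv ℝ f y v) :=
    (hf.fderiv_right (m := 1) le_rfl).clm_apply contDiff_const
  exact (h.continuous_fderiv one_ne_zero).clm_apply continuous_const

theorem ContDiff.continuous_lapl {f : E → ℝ} (hf : ContDiff ℝ 2 f) : Continuous (lapl f) :=
  continuous_finsetSum _ fun _ _ => hf.continuous_fderiv_fderiv _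

theorem tsupport_fderiv_const_apply_subset (f : E → ℝ) (v : E) :
    tsupport (fun y => fderiv ℝ f y v) ⊆ tsupport f :=
  tsupport_fderiv_apply_subset ℝ v

theorem tsupport_lapl_subset (f : E → ℝ) : tsupport (lapl f) ⊆ tsupport f := by
  refine closure_minimal (fun x hx => ?_) (isClosed_tsupport f)
  by_contra h
  refine hx (Finset.sum_eq_zero fun i _ => ?_)
  exact image_eq_zero_of_notMem_tsupport (f := fun x => fderiv ℝ (fun y => fderiv ℝ f y _) x _)
    fun h' => h (tsupport_fderiv_const_apply_subset _ _ (tsupport_fderiv_const_apply_subset _ _ h'))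

theorem continuous_mul_of_tsupport_subset {U : Set E} (hU : IsOpen U) {f g : E → ℝ}
    (hf : ContinuousOn f U) (hg : Continuous g) (h : tsupport g ⊆ U) :
    Continuous (fun x => f x * g x) :=
  (hf.mul hg.continuousOn).continuous_of_tsupport_subset hU
    ((closure_mono (Function.support_mul_subset_right f g)).trans h)

theorem integrable_mul_of_tsupport_subset {U : Set E} (hU : IsOpen U) {f g : E → ℝ}
    (hf : ContinuousOn f U) (hg : Continuous g) (h : tsupport g ⊆ U) (hc : HasCompactSupport g) :
    Integrable (fun x => f x * g x) :=
  (continuous_mul_of_tsupport_subset hU hf hg h).integrable_of_hasCompactSupport hc.mul_left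

theorem HarmonicOnSet.integral_mul_lapl_eq_zero {U : Set E} (hU : IsOpen U) {u φ : E → ℝ}
    (hu : HarmonicOnSet u U) (hφ : ContDiff ℝ 2 φ) (hc : HasCompactSupport φ)
    (hs : tsupport φ ⊆ U) : ∫ x, u x * lapl φ x = 0 := by
  have hu0 : ContinuousOn u U := hu.1.continuousOn
  have hud : ∀ x ∈ U, DifferentiableAt ℝ u x := fun x hx =>
    (hu.1.contDiffAt (hU.mem_nhds hx)).differentiableAt two_ne_zero
  have hu1 (v : E) : ContDiffOn ℝ 1 (fun y => fderiv ℝ u y v) U :=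
    (hu.1.fderiv_of_isOpen hU (m := 1) le_rfl).clm_apply contDiffOn_const
  have hu2 (v : E) : ContinuousOn (fun x => fderiv ℝ (fun y => fderiv ℝ u y v) x v) U :=
    ((hu1 v).continuousOn_fderiv_of_isOpen hU le_rfl).clm_apply continuousOn_const
  have hφ1 (v : E) : ContDiff ℝ 1 (fun y => fderiv ℝ φ y v) :=
    (hφ.fderiv_right (m := 1) le_rfl).clm_apply contDiff_const
  have hs1 (v : E) := (tsupport_fderiv_const_apply_subset φ v).trans hs
  have hs2 (v : E) := (tsupport_fderiv_const_apply_subset (fun y => fderiv ℝ φ y v) v).trans (hs1 v)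
  have hc1 (v : E) : HasCompactSupport (fun y => fderiv ℝ φ y v) := hc.fderiv_apply ℝ v
  have hc2 (v : E) : HasCompactSupport (fun x => fderiv ℝ (fun y => fderiv ℝ φ y v) x v) :=
    (hc1 v).fderiv_apply ℝ v
  have key (v : E) : ∫ x, u x * fderiv ℝ (fun y => fderiv ℝ φ y v) x v =
      ∫ x, fderiv ℝ (fun y => fderiv ℝ u y v) x v * φ x := by
    rw [integral_mul_fderiv_eq_neg_fderiv_mul_of_integrable
        (integrable_mul_of_tsupport_subset hU (hu1 v).continuousOn (hφ1 v).continuous (hs1 v)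
          (hc1 v))
        (integrable_mul_of_tsupport_subset hU hu0 (hφ.continuous_fderiv_fderiv v) (hs2 v) (hc2 v))
        (integrable_mul_of_tsupport_subset hU hu0 (hφ1 v).continuous (hs1 v) (hc1 v))
        (fun x hx => hud x (hs1 v hx))
        (fun x _ => (hφ1 v).differentiable one_ne_zero x),
      integral_mul_fderiv_eq_neg_fderiv_mul_of_integrable
        (integrable_mul_of_tsupport_subset hU (hu2 v) hφ.continuous hs hc)
        (integrable_mul_of_tsupport_subset hU (hu1 v).continuousOn (hφ1 v).continuous (hs1 v)
          (hc1 v))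
        (integrable_mul_of_tsupport_subset hU (hu1 v).continuousOn hφ.continuous hs hc)
        (fun x hx => ((hu1 v).contDiffAt (hU.mem_nhds (hs hx))).differentiableAt one_ne_zero)
        (fun x _ => hφ.differentiable two_ne_zero x), neg_neg]
  calc ∫ x, u x * lapl φ x
      = ∑ i, ∫ x, u x * fderiv ℝ (fun y => fderiv ℝ φ y (EuclideanSpace.single i 1)) x
          (EuclideanSpace.single i 1) := by
        rw [← integral_finsetSum _ fun i _ => integrable_mul_of_tsupport_subset hU hu0
          (hφ.continuous_fderiv_fderiv _) (hs2 _) (hc2 _)]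
        simp only [lapl, Finset.mul_sum]
    _ = ∫ x, lapl u x * φ x := by
        simp only [key]
        rw [← integral_finsetSum _ fun i _ => integrable_mul_of_tsupport_subset hU (hu2 _)
          hφ.continuous hs hc]
        simp only [lapl, Finset.sum_mul]
    _ = 0 := by
        refine integral_eq_zero_of_ae (ae_of_all _ fun x => ?_)
        by_cases hx : x ∈ U
        · simp [hu.2 x hx]
        · simp [image_eq_zero_of_notMem_tsupport fun h => hx (hs h)]

theorem HarmonicOnSet.integral_mul_lapl_eq_zero_of_exp_bound {U : Set E} (hU : IsOpen U)
    {u Φ : E → ℝ} (hu : HarmonicOnSet u U) {C c K δ : ℝ} (hC : 0 ≤ C)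
    (hdecay : ∀ x ∈ U, |u x| ≤ C * Real.exp (-c * ‖x‖)) (hδ : δ < c)
    (hΦ : ContDiff ℝ 2 Φ) (hs : tsupport Φ ⊆ U)
    (h0 : ∀ x, |Φ x| ≤ K * Real.exp (δ * ‖x‖))
    (h1 : ∀ x i, |fderiv ℝ Φ x (EuclideanSpace.single i 1)| ≤ K * Real.exp (δ * ‖x‖))
    (h2 : ∀ x, |lapl Φ x| ≤ K * Real.exp (δ * ‖x‖)) :
    ∫ x, u x * lapl Φ x = 0 := by
  have hK : 0 ≤ K := by
    have := (abs_nonneg _).trans (h0 0)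
    simpa using this
  obtain ⟨χ⟩ : Nonempty (ContDiffBump (0 : E)) := inferInstance
  have hχ : ContDiff ℝ 2 χ := χ.contDiff
  have hχ1 (i : Fin m) : Continuous fun x => fderiv ℝ χ x (EuclideanSpace.single i 1) :=
    (hχ.continuous_fderiv two_ne_zero).clm_apply continuous_const
  have hχr (r : ℝ) : ContDiff ℝ 2 (fun x : E => χ (r • x)) :=
    hχ.comp (contDiff_const_smul r)
  have hform (r : ℝ) (x : E) : lapl (fun y => χ (r • y) * Φ y) x =
      χ (r • x) * lapl Φ x
      + 2 * ∑ i, (r * fderiv ℝ χ (r • x) (EuclideanSpace.single i 1)) *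
          fderiv ℝ Φ x (EuclideanSpace.single i 1)
      + Φ x * (r ^ 2 * lapl χ (r • x)) := by
    rw [lapl_mul (hχr r) hΦ, lapl_comp_smul]
    simp only [fderiv_comp_smul_apply]
  choose M1 hM1 using fun i => (hχ1 i).bounded_above_of_compact_support
    (χ.hasCompactSupport.fderiv_apply ℝ (EuclideanSpace.single i (1 : ℝ)))
  obtain ⟨M2, hM2⟩ := hχ.continuous_lapl.bounded_above_of_compact_support
    (χ.hasCompactSupport.mono' (subset_closure.trans (tsupport_lapl_subset χ)))
  have hzero : ∀ r : ℝ, 0 < r → ∫ x, u x * lapl (fun y => χ (r • y) * Φ y) x = 0 := by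
    intro r hr
    have hcs : HasCompactSupport (fun x : E => χ (r • x)) :=
      χ.hasCompactSupport.comp_smul hr.ne'
    exact hu.integral_mul_lapl_eq_zero hU ((hχr r).mul hΦ) hcs.mul_right
      ((closure_mono (Function.support_mul_subset_right _ _)).trans hs)
  have hlim : Tendsto (fun r : ℝ => ∫ x, u x * lapl (fun y => χ (r • y) * Φ y) x) (𝓝[>] 0)
      (𝓝 (∫ x, u x * lapl Φ x)) := by
    refine tendsto_integral_filter_of_dominated_convergence
      (fun x => C * (K + 2 * ∑ i, M1 i * K + K * M2) * Real.exp (-(c - δ) * ‖x‖)) ?_ ?_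
      ((integrable_exp_neg_mul_norm (sub_pos.2 hδ)).const_mul _) ?_
    · refine Eventually.of_forall fun r => Continuous.aestronglyMeasurable ?_
      exact continuous_mul_of_tsupport_subset hU hu.1.continuousOn
        ((hχr r).mul hΦ).continuous_lapl ((tsupport_lapl_subset _).trans
          ((closure_mono (Function.support_mul_subset_right _ _)).trans hs))
    · filter_upwards [Ioo_mem_nhdsGT (zero_lt_one (α := ℝ))] with r hr
      refine ae_of_all _ fun x => ?_
      have hM20 : 0 ≤ M2 := (norm_nonneg _).trans (hM2 0)
      have hM10 (i) : 0 ≤ M1 i := (norm_nonneg _).trans (hM1 i 0)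
      by_cases hx : x ∈ U
      · have hr1 : |r| ≤ 1 := by rw [abs_of_pos hr.1]; exact hr.2.le
        have hχx : |χ (r • x)| ≤ 1 := by rw [abs_of_nonneg χ.nonneg]; exact χ.le_one
        have e : |lapl (fun y => χ (r • y) * Φ y) x| ≤
            (K + 2 * ∑ i, M1 i * K + K * M2) * Real.exp (δ * ‖x‖) := by
          rw [hform]
          have t1 : |χ (r • x) * lapl Φ x| ≤ 1 * (K * Real.exp (δ * ‖x‖)) := by
            rw [abs_mul]
            exact mul_le_mul hχx (h2 x) (abs_nonneg _) zero_le_one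
          have t2 : |∑ i, (r * fderiv ℝ χ (r • x) (EuclideanSpace.single i 1)) *
              fderiv ℝ Φ x (EuclideanSpace.single i 1)| ≤
              ∑ i, (1 * M1 i) * (K * Real.exp (δ * ‖x‖)) := by
            refine (Finset.abs_sum_le_sum_abs _ _).trans (Finset.sum_le_sum fun i _ => ?_)
            rw [abs_mul, abs_mul]
            have := hM10 i
            gcongr
            · exact hM1 i _
            · exact h1 x i
          have t3 : |Φ x * (r ^ 2 * lapl χ (r • x))| ≤
              (K * Real.exp (δ * ‖x‖)) * (1 * M2) := by
            rw [abs_mul, abs_mul, abs_pow]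
            gcongr
            · exact h0 x
            · exact pow_le_one₀ (abs_nonneg _) hr1
            · exact hM2 _
          have hsum : ∑ i, (1 * M1 i) * (K * Real.exp (δ * ‖x‖)) =
              (∑ i, M1 i * K) * Real.exp (δ * ‖x‖) := by
            rw [Finset.sum_mul]
            exact Finset.sum_congr rfl fun i _ => by ring
          rw [hsum] at t2
          refine (abs_add_le _ _).trans ?_
          refine (add_le_add ((abs_add_le _ _).trans (add_le_add t1 ?_)) t3).trans_eq
            (b := 1 * (K * Real.exp (δ * ‖x‖)) + 2 * ((∑ i, M1 i * K) * Real.exp (δ * ‖x‖)) +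
              (K * Real.exp (δ * ‖x‖)) * (1 * M2)) (by ring)
          rw [abs_mul, abs_two]
          gcongr
        rw [Real.norm_eq_abs, abs_mul]
        refine (mul_le_mul (hdecay x hx) e (abs_nonneg _) (by positivity)).trans_eq ?_
        rw [show -(c - δ) * ‖x‖ = -c * ‖x‖ + δ * ‖x‖ by ring, Real.exp_add]
        ring
      · have hz : lapl (fun y => χ (r • y) * Φ y) x = 0 :=
          image_eq_zero_of_notMem_tsupport fun h => hx (((tsupport_lapl_subset _).trans
          ((closure_mono (Function.support_mul_subset_right _ _)).trans hs)) h)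
        rw [hz, mul_zero, norm_zero]
        have : 0 ≤ ∑ i, M1 i * K := Finset.sum_nonneg fun i _ => mul_nonneg (hM10 i) hK
        positivity
    · refine ae_of_all _ fun x => ?_
      simp only [hform]
      have hcont : Continuous fun r : ℝ => u x * (χ (r • x) * lapl Φ x
          + 2 * ∑ i, (r * fderiv ℝ χ (r • x) (EuclideanSpace.single i 1)) *
            fderiv ℝ Φ x (EuclideanSpace.single i 1)
          + Φ x * (r ^ 2 * lapl χ (r • x))) := by
        have a0 : Continuous fun r : ℝ => r • x := by fun_prop
        have a1 := hχ.continuous.comp a0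
        have a2 := hχ.continuous_lapl.comp a0
        have a3 := fun i => (hχ1 i).comp a0
        simp only [Function.comp_def] at a1 a2 a3
        fun_prop
      have := (hcont.tendsto 0).mono_left (nhdsWithin_le_nhds (s := Set.Ioi 0))
      simpa [χ.one_of_mem_closedBall (Metric.mem_closedBall_self χ.rIn_pos.le)] using this
  refine tendsto_nhds_unique hlim (tendsto_const_nhds.congr' ?_)
  filter_upwards [self_mem_nhdsWithin] with r hr
  exact (hzero r hr).symm

end Green

open FourierTransform in
theorem eq_zero_of_integral_mul_exp_inner_eq_zero {m : ℕ} {w : EuclideanSpace ℝ (Fin m) → ℝ}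
    (hw : Continuous w) {C c : ℝ} (hc : 0 < c) (hdecay : ∀ x, |w x| ≤ C * Real.exp (-c * ‖x‖))
    (hzero : ∀ a : EuclideanSpace ℝ (Fin m), ‖a‖ < c → ∫ x, w x * Real.exp (inner ℝ a x) = 0) :
    w = 0 := by
  have hC : 0 ≤ C := by simpa using (abs_nonneg _).trans (hdecay 0)
  let W : EuclideanSpace ℝ (Fin m) → ℂ := fun x => (w x : ℂ)
  have hWc : Continuous W := by fun_prop
  have hWi : Integrable W := by
    refine ((integrable_exp_neg_mul_norm hc).const_mul C).mono' hWc.aestronglyMeasurable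
      (ae_of_all _ fun x => ?_)
    simpa [W] using hdecay x
  have hF : 𝓕 W = 0 := by
    ext ξ
    let G : ℂ → ℂ := fun z => ∫ x, W x * Complex.exp (z * (inner ℝ ξ x : ℝ))
    let S : ℝ → Set ℂ := fun δ => {z | |z.re| * ‖ξ‖ < δ}
    have hSo (δ : ℝ) : IsOpen (S δ) := isOpen_lt (by fun_prop) continuous_const
    have hbd {δ : ℝ} {z : ℂ} (hz : z ∈ S δ) (x : EuclideanSpace ℝ (Fin m)) :
        ‖W x * Complex.exp (z * (inner ℝ ξ x : ℝ))‖ ≤ C * Real.exp (-(c - δ) * ‖x‖) := by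
      rw [norm_mul, Complex.norm_exp, Complex.re_mul_ofReal,
        show -(c - δ) * ‖x‖ = -c * ‖x‖ + δ * ‖x‖ by ring, Real.exp_add, ← mul_assoc]
      have h1 : ‖W x‖ ≤ C * Real.exp (-c * ‖x‖) := by simpa [W] using hdecay x
      refine mul_le_mul h1 (Real.exp_le_exp.2 ?_) (Real.exp_pos _).le (by positivity)
      calc z.re * inner ℝ ξ x ≤ |z.re| * |inner ℝ ξ x| := by
            rw [← abs_mul]; exact le_abs_self _
        _ ≤ |z.re| * (‖ξ‖ * ‖x‖) := by gcongr; exact abs_real_inner_le_norm ξ x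
        _ = (|z.re| * ‖ξ‖) * ‖x‖ := by ring
        _ ≤ δ * ‖x‖ := by
          have : |z.re| * ‖ξ‖ < δ := hz
          gcongr
    have hcont (z : ℂ) : Continuous fun x => W x * Complex.exp (z * (inner ℝ ξ x : ℝ)) := by
      fun_prop
    have hdiff : DifferentiableOn ℂ G (S c) := by
      intro z hz
      obtain ⟨δ, hzδ, hδ⟩ := exists_between (show |z.re| * ‖ξ‖ < c from hz)
      have hγ : 0 < (c - δ) / 2 := by linarith
      refine DifferentiableAt.differentiableWithinAt ?_
      refine (hasDerivAt_integral_of_dominated_loc_of_deriv_le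
        (bound := fun x => ‖ξ‖ * C * (1 + 1 / ((c - δ) / 2)) * Real.exp (-((c - δ) / 2) * ‖x‖))
        (F' := fun z x => W x * Complex.exp (z * (inner ℝ ξ x : ℝ)) * (inner ℝ ξ x : ℝ))
        ((hSo δ).mem_nhds hzδ)
        (Eventually.of_forall fun z => (hcont z).aestronglyMeasurable) ?_
        (Continuous.aestronglyMeasurable (by fun_prop)) (ae_of_all _ fun x z hz => ?_)
        ((integrable_exp_neg_mul_norm hγ).const_mul _)
        (ae_of_all _ fun x z hz => ?_)).2.differentiableAt
      · exact ((integrable_exp_neg_mul_norm (sub_pos.2 hδ)).const_mul C).mono'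
          (hcont z).aestronglyMeasurable (ae_of_all _ (hbd hzδ))
      · have h1 := one_add_le_exp hγ ‖x‖ (norm_nonneg x)
        have h2 : ‖((inner ℝ ξ x : ℝ) : ℂ)‖ ≤
            ‖ξ‖ * ((1 + 1 / ((c - δ) / 2)) * Real.exp ((c - δ) / 2 * ‖x‖)) := by
          rw [Complex.norm_real]
          refine (norm_inner_le_norm ξ x).trans ?_
          gcongr
          linarith
        rw [norm_mul]
        refine (mul_le_mul (hbd hz x) h2 (norm_nonneg _) (by positivity)).trans_eq ?_
        rw [show -((c - δ) / 2) * ‖x‖ = -(c - δ) * ‖x‖ + (c - δ) / 2 * ‖x‖ by ring, Real.exp_add]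
        ring
      · have := (((hasDerivAt_id z).mul_const ((inner ℝ ξ x : ℝ) : ℂ)).cexp).const_mul (W x)
        simpa [mul_assoc] using this
    have hpre : IsPreconnected (S c) := by
      refine Convex.isPreconnected ?_
      have : ConvexOn ℝ Set.univ fun z : ℂ => ‖ξ‖ * ‖z.re‖ :=
        ((convexOn_norm convex_univ).comp_linearMap Complex.reLm).smul (norm_nonneg ξ)
      convert! this.convex_lt c using 1
      ext z
      simp [S, mul_comm]
    have h0 : (0 : ℂ) ∈ S c := by simpa [S] using hc
    have hfreq : ∃ᶠ z in 𝓝[≠] (0 : ℂ), G z = 0 := by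
      have hmap : Tendsto (fun s : ℝ => (s : ℂ)) (𝓝[≠] 0) (𝓝[≠] 0) := by
        refine tendsto_nhdsWithin_iff.2 ⟨?_, ?_⟩
        · exact (Complex.continuous_ofReal.tendsto' 0 0 (by simp)).mono_left nhdsWithin_le_nhds
        · filter_upwards [self_mem_nhdsWithin] with s hs
          simpa using hs
      refine hmap.frequently (Eventually.frequently ?_)
      have hsmall : ∀ᶠ s : ℝ in 𝓝 0, ‖s • ξ‖ < c := by
        have : Continuous fun s : ℝ => ‖s • ξ‖ := by fun_prop
        exact this.tendsto 0 |>.eventually_lt_const (by simpa using hc)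
      filter_upwards [hsmall.filter_mono nhdsWithin_le_nhds] with s hs
      have := hzero _ hs
      simp only [inner_smul_left] at this
      have h' := congrArg (fun r : ℝ => (r : ℂ)) this
      simp only [← integral_complex_ofReal] at h'
      simpa [G, W] using h'
    have hG : Set.EqOn G 0 (S c) :=
      (hdiff.analyticOnNhd (hSo c)).eqOn_zero_of_preconnected_of_frequently_eq_zero hpre h0 hfreq
    have hz : (-2 * Real.pi * Complex.I : ℂ) ∈ S c := by simpa [S] using hc
    have := hG hz
    rw [Real.fourier_eq']
    simp only [G, Pi.zero_apply] at this ⊢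
    rw [← this]
    refine integral_congr_ae (ae_of_all _ fun x => ?_)
    simp only [smul_eq_mul, mul_comm (W x)]
    rw [real_inner_comm]
    push_cast
    ring_nf
  have hinv := hWc.fourierInv_fourier_eq hWi (by rw [hF]; exact integrable_zero _ _ _)
  rw [hF] at hinv
  ext x
  have hx := congrFun hinv x
  rw [Real.fourierInv_eq] at hx
  simpa [W] using hx.symm

theorem exists_cos_sin_like (α : ℝ) : ∃ p q : ℝ → ℝ,
    (∀ t, HasDerivAt p (-α ^ 2 * q t) t) ∧ (∀ t, HasDerivAt q (p t) t) ∧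
    (∀ t, p t ^ 2 + α ^ 2 * q t ^ 2 = 1) ∧
    ∃ K, 0 ≤ K ∧ ∀ t, |p t| ≤ K * (1 + |t|) ∧ |q t| ≤ K * (1 + |t|) := by
  by_cases hα : α = 0
  · subst hα
    refine ⟨fun _ => 1, fun t => t, fun t => ?_, fun t => hasDerivAt_id t, by simp, 1, zero_le_one,
      fun t => ?_⟩
    · simpa using hasDerivAt_const t (1 : ℝ)
    · have := abs_nonneg t
      simp [this]
  · have hlin (t : ℝ) : HasDerivAt (fun t => α * t) α t := by
      simpa using (hasDerivAt_id t).const_mul α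
    refine ⟨fun t => Real.cos (α * t), fun t => Real.sin (α * t) / α, fun t => ?_, fun t => ?_,
      fun t => ?_, 1 + |α|⁻¹, by positivity, fun t => ⟨?_, ?_⟩⟩
    · convert! (hlin t).cos using 1
      field_simp
    · convert! (hlin t).sin.div_const α using 1
      field_simp
    · field_simp
      exact Real.cos_sq_add_sin_sq _
    · refine (Real.abs_cos_le_one _).trans ?_
      have h1 : 0 ≤ |α|⁻¹ := by positivity
      nlinarith [abs_nonneg t, mul_nonneg h1 (abs_nonneg t)]
    · rw [abs_div]
      have h1 : 0 ≤ |α|⁻¹ := by positivity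
      have h2 : |Real.sin (α * t)| / |α| ≤ 1 / |α| := by
        gcongr
        exact Real.abs_sin_le_one _
      rw [one_div] at h2
      nlinarith [abs_nonneg t, mul_nonneg h1 (abs_nonneg t)]

theorem exists_bound_intervalIntegral {h : ℝ → ℝ} (hh : Continuous h) (hc : HasCompactSupport h)
    (ε : ℝ) : ∃ B, 0 ≤ B ∧ ∀ t, |∫ s in ε..t, h s| ≤ B := by
  have hi := (hh.integrable_of_hasCompactSupport hc (μ := volume)).norm
  refine ⟨∫ s, ‖h s‖, integral_nonneg fun _ => norm_nonneg _, fun t => ?_⟩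
  exact intervalIntegral.norm_integral_le_integral_norm_uIoc.trans
    (setIntegral_le_integral hi (ae_of_all _ fun _ => norm_nonneg _))

theorem exists_forced_oscillator (α ε : ℝ) {g : ℝ → ℝ} (hg : Continuous g)
    (hgc : HasCompactSupport g) (hgε : ∀ t ≤ ε, g t = 0) :
    ∃ θ θ' : ℝ → ℝ, (∀ t, HasDerivAt θ (θ' t) t) ∧
      (∀ t, HasDerivAt θ' (g t - α ^ 2 * θ t) t) ∧ (∀ t ≤ ε, θ t = 0) ∧
      ∃ K, 0 ≤ K ∧ ∀ t, |θ t| ≤ K * (1 + |t|) ∧ |θ' t| ≤ K * (1 + |t|) := by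
  obtain ⟨p, q, hp, hq, hpq, K, hK, hbd⟩ := exists_cos_sin_like α
  have hpc : Continuous p := continuous_iff_continuousAt.2 fun t => (hp t).continuousAt
  have hqc : Continuous q := continuous_iff_continuousAt.2 fun t => (hq t).continuousAt
  let P : ℝ → ℝ := fun t => ∫ s in ε..t, p s * g s
  let Q : ℝ → ℝ := fun t => ∫ s in ε..t, q s * g s
  have hP (t : ℝ) : HasDerivAt P (p t * g t) t := (hpc.mul hg).integral_hasStrictDerivAt ε t
    |>.hasDerivAt
  have hQ (t : ℝ) : HasDerivAt Q (q t * g t) t := (hqc.mul hg).integral_hasStrictDerivAt ε t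
    |>.hasDerivAt
  obtain ⟨B₁, hB₁, hPB⟩ := exists_bound_intervalIntegral (hpc.mul hg) hgc.mul_left ε
  obtain ⟨B₂, hB₂, hQB⟩ := exists_bound_intervalIntegral (hqc.mul hg) hgc.mul_left ε
  have hvan (f : ℝ → ℝ) {t : ℝ} (ht : t ≤ ε) : ∫ s in ε..t, f s * g s = 0 := by
    rw [intervalIntegral.integral_congr (g := fun _ => 0), intervalIntegral.integral_zero]
    intro s hs
    rw [Set.uIcc_of_ge ht] at hs
    simp [hgε s hs.2]
  refine ⟨fun t => q t * P t - p t * Q t, fun t => p t * P t + α ^ 2 * (q t * Q t),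
    fun t => ?_, fun t => ?_, fun t ht => ?_, K * (B₁ + B₂) + α ^ 2 * (K * B₂) + K * B₁,
    by positivity, fun t => ⟨?_, ?_⟩⟩
  · convert! ((hq t).mul (hP t)).sub ((hp t).mul (hQ t)) using 1
    ring
  · convert! ((hp t).mul (hP t)).add (((hq t).mul (hQ t)).const_mul (α ^ 2)) using 1
    linear_combination -(g t) * hpq t
  · simp [P, Q, hvan _ ht]
  all_goals
    have h1 := (hbd t).1
    have h2 := (hbd t).2
    have h3 : |P t| ≤ B₁ := hPB t
    have h4 : |Q t| ≤ B₂ := hQB t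
    have hKt : 0 ≤ K * (1 + |t|) := by positivity
    have e1 : |q t * P t| ≤ K * (1 + |t|) * B₁ := by
      rw [abs_mul]; exact mul_le_mul h2 h3 (abs_nonneg _) hKt
    have e2 : |p t * Q t| ≤ K * (1 + |t|) * B₂ := by
      rw [abs_mul]; exact mul_le_mul h1 h4 (abs_nonneg _) hKt
    have e3 : |p t * P t| ≤ K * (1 + |t|) * B₁ := by
      rw [abs_mul]; exact mul_le_mul h1 h3 (abs_nonneg _) hKt
    have e4 : |α ^ 2 * (q t * Q t)| ≤ α ^ 2 * (K * (1 + |t|) * B₂) := by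
      rw [abs_mul, abs_of_nonneg (sq_nonneg α), abs_mul]
      gcongr
  · refine (abs_sub _ _).trans ?_
    have : 0 ≤ α ^ 2 * (K * (1 + |t|) * B₂) + K * (1 + |t|) * B₁ := by positivity
    linarith
  · refine (abs_add_le _ _).trans ?_
    have : 0 ≤ K * (1 + |t|) * (B₁ + B₂) := by positivity
    linarith

theorem fderiv_exp_inner_mul_comp_coord {m : ℕ} (a : EuclideanSpace ℝ (Fin m)) (j : Fin m)
    {θ θ' : ℝ → ℝ} (hθ : ∀ t, HasDerivAt θ (θ' t) t) (v x : EuclideanSpace ℝ (Fin m)) :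
    fderiv ℝ (fun y => Real.exp (inner ℝ a y) * θ (y j)) x v =
      inner ℝ a v * (Real.exp (inner ℝ a x) * θ (x j)) +
        v j * (Real.exp (inner ℝ a x) * θ' (x j)) := by
  have h1 : HasFDerivAt (fun y => Real.exp (inner ℝ a y))
      (Real.exp (inner ℝ a x) • innerSL ℝ a) x := (innerSL ℝ a).hasFDerivAt.exp
  have h2 : HasFDerivAt (fun y : EuclideanSpace ℝ (Fin m) => θ (y j))
      (θ' (x j) • (EuclideanSpace.proj j : EuclideanSpace ℝ (Fin m) →L[ℝ] ℝ)) x :=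
    (hθ (x j)).comp_hasFDerivAt x
      (EuclideanSpace.proj j : EuclideanSpace ℝ (Fin m) →L[ℝ] ℝ).hasFDerivAt
  rw [(h1.fun_mul h2).fderiv]
  simp only [add_apply, smul_apply, smul_eq_mul, innerSL_apply_apply,
    EuclideanSpace.coe_proj]
  ring

theorem contDiff_two_of_hasDerivAt {θ θ' θ'' : ℝ → ℝ} (h1 : ∀ t, HasDerivAt θ (θ' t) t)
    (h2 : ∀ t, HasDerivAt θ' (θ'' t) t) (hc : Continuous θ'') : ContDiff ℝ 2 θ := by
  rw [show (2 : WithTop ℕ∞) = 1 + 1 from rfl, contDiff_succ_iff_deriv]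
  refine ⟨fun t => (h1 t).differentiableAt, by simp, ?_⟩
  rw [funext fun t => (h1 t).deriv, contDiff_one_iff_deriv]
  refine ⟨fun t => (h2 t).differentiableAt, ?_⟩
  rwa [funext fun t => (h2 t).deriv]

theorem lapl_exp_inner_mul_comp_coord {m : ℕ} (a : EuclideanSpace ℝ (Fin m)) (j : Fin m)
    {θ θ' θ'' : ℝ → ℝ} (h1 : ∀ t, HasDerivAt θ (θ' t) t) (h2 : ∀ t, HasDerivAt θ' (θ'' t) t)
    (x : EuclideanSpace ℝ (Fin m)) :
    lapl (fun y => Real.exp (inner ℝ a y) * θ (y j)) x =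
      Real.exp (inner ℝ a x) * (‖a‖ ^ 2 * θ (x j) + 2 * a j * θ' (x j) + θ'' (x j)) := by
  have hE : Differentiable ℝ fun y : EuclideanSpace ℝ (Fin m) => Real.exp (inner ℝ a y) :=
    (innerSL ℝ a).differentiable.exp
  have hcoord {ψ ψ' : ℝ → ℝ} (h : ∀ t, HasDerivAt ψ (ψ' t) t) :
      Differentiable ℝ fun y : EuclideanSpace ℝ (Fin m) => ψ (y j) := by
    have : Differentiable ℝ ψ := fun t => (h t).differentiableAt
    fun_prop
  have key (v : EuclideanSpace ℝ (Fin m)) :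
      fderiv ℝ (fun y => fderiv ℝ (fun y => Real.exp (inner ℝ a y) * θ (y j)) y v) x v =
      Real.exp (inner ℝ a x) * (inner ℝ a v ^ 2 * θ (x j) + 2 * (inner ℝ a v * v j) * θ' (x j) +
        v j ^ 2 * θ'' (x j)) := by
    simp_rw [fderiv_exp_inner_mul_comp_coord a j h1]
    have hm1 := (hE.fun_mul (hcoord h1)) x
    have hm2 := (hE.fun_mul (hcoord h2)) x
    rw [fderiv_fun_add (hm1.const_mul _) (hm2.const_mul _), fderiv_const_mul hm1,
      fderiv_const_mul hm2]
    simp only [add_apply, smul_apply, smul_eq_mul, fderiv_exp_inner_mul_comp_coord a j h1,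
      fderiv_exp_inner_mul_comp_coord a j h2]
    ring
  simp only [lapl, key, ← Finset.mul_sum, Finset.sum_add_distrib, ← Finset.sum_mul]
  simp [EuclideanSpace.inner_single_right, EuclideanSpace.real_norm_sq_eq]

theorem HarmonicOnSet.integral_mul_exp_inner_eq_zero {n : ℕ}
    {u : EuclideanSpace ℝ (Fin (n + 1)) → ℝ}
    (hu : HarmonicOnSet u {x | 0 < x (Fin.last n)}) {C c : ℝ} (hC : 0 ≤ C)
    (hdecay : ∀ x : EuclideanSpace ℝ (Fin (n + 1)), 0 < x (Fin.last n) →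
      |u x| ≤ C * Real.exp (-c * ‖x‖))
    {a : EuclideanSpace ℝ (Fin (n + 1))} (ha : ‖a‖ < c) (ha0 : a (Fin.last n) = 0)
    {g : ℝ → ℝ} (hg : Continuous g) (hgc : HasCompactSupport g) {ε : ℝ} (hε : 0 < ε)
    (hgε : ∀ t ≤ ε, g t = 0) :
    ∫ x, u x * (Real.exp (inner ℝ a x) * g (x (Fin.last n))) = 0 := by
  have hU : IsOpen {x : EuclideanSpace ℝ (Fin (n + 1)) | 0 < x (Fin.last n)} :=
    isOpen_lt continuous_const (by fun_prop)
  obtain ⟨θ, θ', h1, h2, hθε, K, hK, hbd⟩ := exists_forced_oscillator ‖a‖ ε hg hgc hgε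
  obtain ⟨M, hM⟩ := hg.bounded_above_of_compact_support hgc
  have hM0 : 0 ≤ M := (norm_nonneg _).trans (hM 0)
  have hθ : ContDiff ℝ 2 θ := by
    have hθc : Continuous θ := continuous_iff_continuousAt.2 fun t => (h1 t).continuousAt
    exact contDiff_two_of_hasDerivAt h1 h2 (by fun_prop)
  set Φ : EuclideanSpace ℝ (Fin (n + 1)) → ℝ :=
    fun y => Real.exp (inner ℝ a y) * θ (y (Fin.last n)) with hΦdef
  have hΦ : ContDiff ℝ 2 Φ :=
    ((innerSL ℝ a).contDiff.exp).mul (hθ.comp (by fun_prop))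
  have hlapl : lapl Φ = fun x => Real.exp (inner ℝ a x) * g (x (Fin.last n)) := by
    ext x
    rw [hΦdef, lapl_exp_inner_mul_comp_coord a _ h1 h2, ha0]
    ring
  have hs : tsupport Φ ⊆ {x : EuclideanSpace ℝ (Fin (n + 1)) | 0 < x (Fin.last n)} := by
    have hcl : IsClosed {x : EuclideanSpace ℝ (Fin (n + 1)) | ε ≤ x (Fin.last n)} :=
      isClosed_le continuous_const (by fun_prop)
    refine (closure_minimal (fun x hx => ?_) hcl).trans fun x hx => hε.trans_le hx
    by_contra h
    exact hx (by simp [Φ, hθε _ (not_le.1 h).le])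
  have hγ : 0 < (c - ‖a‖) / 2 := by linarith
  set γ := (c - ‖a‖) / 2 with hγdef
  set D := 1 + 1 / γ with hD
  have hD0 : 0 ≤ D := by positivity
  have hlin (x : EuclideanSpace ℝ (Fin (n + 1))) :
      1 + |x (Fin.last n)| ≤ D * Real.exp (γ * ‖x‖) := by
    have := PiLp.norm_apply_le x (Fin.last n)
    rw [Real.norm_eq_abs] at this
    linarith [one_add_le_exp hγ ‖x‖ (norm_nonneg x)]
  have hexp (x : EuclideanSpace ℝ (Fin (n + 1))) :
      Real.exp (inner ℝ a x) ≤ Real.exp (‖a‖ * ‖x‖) :=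
    Real.exp_le_exp.2 (real_inner_le_norm a x)
  have hprod {ψ B : ℝ} (x : EuclideanSpace ℝ (Fin (n + 1))) (hB : 0 ≤ B)
      (hψ : |ψ| ≤ B * (1 + |x (Fin.last n)|)) :
      |Real.exp (inner ℝ a x) * ψ| ≤ B * D * Real.exp ((‖a‖ + γ) * ‖x‖) := by
    rw [abs_mul, abs_of_pos (Real.exp_pos _), add_mul, Real.exp_add]
    refine (mul_le_mul (hexp x) (hψ.trans (mul_le_mul_of_nonneg_left (hlin x) hB))
      (abs_nonneg _) (Real.exp_pos _).le).trans_eq ?_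
    ring
  rw [show (fun x => u x * (Real.exp (inner ℝ a x) * g (x (Fin.last n)))) =
    fun x => u x * lapl Φ x by rw [hlapl]]
  refine hu.integral_mul_lapl_eq_zero_of_exp_bound hU hC hdecay (δ := ‖a‖ + γ)
    (K := (‖a‖ + 1) * (K * D) + M * D) (by linarith) hΦ hs (fun x => ?_) (fun x i => ?_)
    fun x => ?_
  · refine (hprod x hK (hbd _).1).trans ?_
    gcongr
    have : 0 ≤ ‖a‖ * (K * D) + M * D := by positivity
    linarith
  · rw [fderiv_exp_inner_mul_comp_coord a _ h1]
    refine (abs_add_le _ _).trans ?_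
    rw [abs_mul (inner ℝ a _), abs_mul ((EuclideanSpace.single i (1 : ℝ)).ofLp _)]
    have hi : |inner ℝ a (EuclideanSpace.single i (1 : ℝ))| ≤ ‖a‖ :=
      (abs_real_inner_le_norm _ _).trans_eq (by simp)
    have hj : |(EuclideanSpace.single i (1 : ℝ) : EuclideanSpace ℝ (Fin (n + 1))) (Fin.last n)| ≤ 1 :=
      (PiLp.norm_apply_le (EuclideanSpace.single i (1 : ℝ)) (Fin.last n)).trans_eq (by simp)
    have := add_le_add
      (mul_le_mul hi (hprod x hK (hbd _).1) (abs_nonneg _) (norm_nonneg a))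
      (mul_le_mul hj (hprod x hK (hbd _).2) (abs_nonneg _) zero_le_one)
    refine this.trans ?_
    have : 0 ≤ M * D * Real.exp ((‖a‖ + γ) * ‖x‖) := by positivity
    linarith
  · rw [hlapl]
    refine (hprod x hM0 (B := M) ?_).trans ?_
    · have := hM (x (Fin.last n))
      rw [Real.norm_eq_abs] at this
      nlinarith [abs_nonneg (x (Fin.last n))]
    · gcongr
      have : 0 ≤ (‖a‖ + 1) * (K * D) := by positivity
      linarith

/-- **Liouville-type theorem (Armitage).** If `ũ` is harmonic on the open upper half-space
`ℝ^{n+1}_+` and `|ũ(x)| ≤ C e^{−c|x|}` there, then `ũ ≡ 0` on `ℝ^{n+1}_+`. -/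
theorem liouville_halfspace_exponential_decay (n : ℕ) (hn : 1 ≤ n)
    (u : EuclideanSpace ℝ (Fin (n+1)) → ℝ)
    (hharm : HarmonicOnSet u {x | 0 < x (Fin.last n)})
    (C c : ℝ) (hC : 0 < C) (hc : 0 < c)
    (hdecay : ∀ x : EuclideanSpace ℝ (Fin (n+1)), 0 < x (Fin.last n) →
      |u x| ≤ C * Real.exp (-c * ‖x‖)) :
    ∀ x : EuclideanSpace ℝ (Fin (n+1)), 0 < x (Fin.last n) → u x = 0 := by
  intro x₀ hx₀
  set r := x₀ (Fin.last n) / 2 with hr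
  have hr0 : 0 < r := half_pos hx₀
  have hx₀r : x₀ (Fin.last n) = 2 * r := by rw [hr]; ring
  let ρ : ℝ → ℝ := fun t => max 0 (r - |t - 2 * r|)
  have hρ : Continuous ρ := by fun_prop
  have hρr : ∀ t ≤ r, ρ t = 0 := fun t ht => by
    refine max_eq_left ?_
    have := neg_le_abs (t - 2 * r)
    linarith
  have hρc : HasCompactSupport ρ := by
    refine HasCompactSupport.intro (isCompact_Icc (a := r) (b := 3 * r)) fun t ht => ?_
    by_cases h : t ≤ r
    · exact hρr t h
    · refine max_eq_left ?_
      have h3 : 3 * r < t := by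
        by_contra h'
        exact ht ⟨(not_le.1 h).le, not_lt.1 h'⟩
      have := le_abs_self (t - 2 * r)
      linarith
  have hρ1 : ∀ t, |ρ t| ≤ r := fun t => by
    rw [abs_of_nonneg (le_max_left _ _)]
    exact max_le hr0.le (by linarith [abs_nonneg (t - 2 * r)])
  let w : EuclideanSpace ℝ (Fin (n + 1)) → ℝ := fun x => u x * ρ (x (Fin.last n))
  have hU : IsOpen {x : EuclideanSpace ℝ (Fin (n + 1)) | 0 < x (Fin.last n)} :=
    isOpen_lt continuous_const (by fun_prop)
  have hw : Continuous w := by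
    refine continuous_mul_of_tsupport_subset hU hharm.1.continuousOn (by fun_prop) ?_
    have hcl : IsClosed {x : EuclideanSpace ℝ (Fin (n + 1)) | r ≤ x (Fin.last n)} :=
      isClosed_le continuous_const (by fun_prop)
    refine (closure_minimal (fun x hx => ?_) hcl).trans fun x hx => hr0.trans_le hx
    by_contra h
    exact hx (hρr _ (not_le.1 h).le)
  have hwd : ∀ x, |w x| ≤ C * r * Real.exp (-c * ‖x‖) := fun x => by
    by_cases hx : 0 < x (Fin.last n)
    · rw [abs_mul]
      refine (mul_le_mul (hdecay x hx) (hρ1 _) (abs_nonneg _) (by positivity)).trans_eq ?_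
      ring
    · simp only [w, hρr _ ((not_lt.1 hx).trans hr0.le), mul_zero, abs_zero]
      positivity
  have hw0 := eq_zero_of_integral_mul_exp_inner_eq_zero hw hc hwd fun a ha => by
    set b := a (Fin.last n) with hb
    set a' := a - EuclideanSpace.single (Fin.last n) b with ha'
    have ha'0 : a' (Fin.last n) = 0 := by simp [ha', hb]
    have hsplit : a = a' + EuclideanSpace.single (Fin.last n) b := by simp [ha']
    have horth : inner ℝ a' (EuclideanSpace.single (Fin.last n) b) = 0 := by
      simp [EuclideanSpace.inner_single_right, ha'0]
    have hnorm : ‖a'‖ ≤ ‖a‖ := by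
      have h := norm_add_sq_eq_norm_sq_add_norm_sq_of_inner_eq_zero _ _ horth
      rw [← hsplit] at h
      refine abs_le_of_sq_le_sq' ?_ (norm_nonneg a) |>.2
      nlinarith [mul_self_nonneg ‖(EuclideanSpace.single (Fin.last n) b :
        EuclideanSpace ℝ (Fin (n + 1)))‖]
    have := hharm.integral_mul_exp_inner_eq_zero hC.le hdecay (hnorm.trans_lt ha) ha'0
      (g := fun t => ρ t * Real.exp (b * t)) (by fun_prop) hρc.mul_right hr0
      fun t ht => by rw [hρr t ht, zero_mul]
    rw [← this]
    refine integral_congr_ae (ae_of_all _ fun x => ?_)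
    have hin : inner ℝ a x = inner ℝ a' x + b * x (Fin.last n) := by
      conv_lhs => rw [hsplit]
      rw [inner_add_left, EuclideanSpace.inner_single_left]
      simp
    simp only [w, hin, Real.exp_add]
    ring
  have h := congrFun hw0 x₀
  have hρx : ρ (x₀ (Fin.last n)) = r := by simp [ρ, hx₀r, hr0.le]
  simpa [w, hρx, hr0.ne'] using h
end

section
/- Let n ≥ 1. The image under Φ of the open upper half-space ℝ^{n+1}_+ = {x = (x', x_{n+1}) ∈ ℝⁿ × ℝ : x_{n+1} > 0} equals the open unit ball B₁(0) = {z ∈ ℝ^{n+1} : |z| < 1}. -/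
open MeasureTheory

theorem Phi_sub_southPole {n : ℕ} (z : EuclideanSpace ℝ (Fin (n+1))) :
    Phi z - southPole n = (2 / ‖z - southPole n‖ ^ 2) • (z - southPole n) :=
  add_sub_cancel_right _ _

theorem Phi_ne_southPole {n : ℕ} {z : EuclideanSpace ℝ (Fin (n+1))} (hz : z ≠ southPole n) :
    Phi z ≠ southPole n := by
  have h : z - southPole n ≠ 0 := sub_ne_zero.2 hz
  have h' : ‖z - southPole n‖ ≠ 0 := norm_ne_zero_iff.2 h
  rw [← sub_ne_zero, Phi_sub_southPole]
  exact smul_ne_zero (by positivity) h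

theorem Phi_Phi {n : ℕ} {z : EuclideanSpace ℝ (Fin (n+1))} (hz : z ≠ southPole n) :
    Phi (Phi z) = z := by
  have h : ‖z - southPole n‖ ≠ 0 := norm_ne_zero_iff.2 (sub_ne_zero.2 hz)
  rw [← sub_left_inj (a := southPole n), Phi_sub_southPole, Phi_sub_southPole, norm_smul, smul_smul,
    Real.norm_of_nonneg (by positivity)]
  convert one_smul ℝ (z - southPole n) using 2
  field_simp

theorem norm_southPole (n : ℕ) : ‖southPole n‖ = 1 := by
  simp [southPole]

theorem inner_southPole {n : ℕ} (z : EuclideanSpace ℝ (Fin (n+1))) :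
    inner ℝ z (southPole n) = -z (Fin.last n) := by
  simp [southPole, EuclideanSpace.inner_single_right]

theorem norm_Phi_sq {n : ℕ} {z : EuclideanSpace ℝ (Fin (n+1))} (hz : z ≠ southPole n) :
    ‖Phi z‖ ^ 2 = 1 - 4 * z (Fin.last n) / ‖z - southPole n‖ ^ 2 := by
  have h : ‖z - southPole n‖ ≠ 0 := norm_ne_zero_iff.2 (sub_ne_zero.2 hz)
  rw [Phi, norm_add_sq_real, norm_smul, real_inner_smul_left, inner_sub_left, inner_southPole,
    real_inner_self_eq_norm_sq, norm_southPole, Real.norm_of_nonneg (by positivity)]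
  field_simp
  ring

theorem norm_Phi_lt_one_iff {n : ℕ} {z : EuclideanSpace ℝ (Fin (n+1))} (hz : z ≠ southPole n) :
    ‖Phi z‖ < 1 ↔ 0 < z (Fin.last n) := by
  have h : 0 < ‖z - southPole n‖ ^ 2 := by
    have := norm_pos_iff.2 (sub_ne_zero.2 hz)
    positivity
  rw [← sq_lt_one_iff₀ (norm_nonneg _), norm_Phi_sq hz, sub_lt_self_iff, div_pos_iff_of_pos_right h]
  simp

/-- `Φ` maps the open upper half-space `ℝ^{n+1}_+` onto the open unit ball `B₁(0)`. -/
theorem Phi_image_halfspace (n : ℕ) (hn : 1 ≤ n) :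
    Phi '' {x : EuclideanSpace ℝ (Fin (n+1)) | 0 < x (Fin.last n)} =
      Metric.ball (0 : EuclideanSpace ℝ (Fin (n+1))) 1 := by
  ext y
  simp only [Set.mem_image, Set.mem_ofPred_eq, mem_ball_zero_iff]
  constructor
  · rintro ⟨x, hx, rfl⟩
    refine (norm_Phi_lt_one_iff ?_).2 hx
    rintro rfl
    norm_num [southPole] at hx
  · intro hy
    have hs : y ≠ southPole n := by
      rintro rfl
      exact hy.ne (norm_southPole n)
    refine ⟨Phi y, ?_, Phi_Phi hs⟩
    rwa [← norm_Phi_lt_one_iff (Phi_ne_southPole hs), Phi_Phi hs]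
end

section
/- Let n ≥ 1, let p ∈ (1, ∞), and let λ, Λ, M > 0. Suppose u : ℝⁿ → ℝ is twice continuously differentiable, satisfies |u(x)| ≤ Λ e^{−λ|x|} for all x ∈ ℝⁿ, and for every j ∈ {1, …, n} the Lᵖ(ℝⁿ) norms of ∂_j u and ∂_j² u are both at most M. Then there exists a constant C > 0, depending only on n, p, λ, Λ and M, such that ∫_{ℝⁿ} e^{λ|x|/2} |∇u(x)|² dx ≤ C. -/
open MeasureTheory

section WeightedGradient

variable {E : Type*} [NormedAddCommGroup E]

lemma continuous_exp_neg_mul_norm (c : ℝ) : Continuous fun x : E => Real.exp (-c * ‖x‖) := by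
  fun_prop

lemma integrable_exp_neg_mul_norm_s11 [NormedSpace ℝ E] [FiniteDimensional ℝ E]
    [MeasurableSpace E] [BorelSpace E] (μ : Measure E) [μ.IsAddHaarMeasure]
    {c : ℝ} (hc : 0 < c) : Integrable (fun x : E => Real.exp (-c * ‖x‖)) μ := by
  set N : ℕ := Module.finrank ℝ E + 1 with hN
  have hint : Integrable (fun x : E => (1 + ‖x‖) ^ (-(N : ℝ))) μ :=
    integrable_one_add_norm (by rw [hN]; push_cast; linarith)
  refine (hint.const_mul (Real.exp c * (N.factorial / c ^ N))).mono'
    (continuous_exp_neg_mul_norm c).aestronglyMeasurable (.of_forall fun x => ?_)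
  have h1 : 0 < 1 + ‖x‖ := by positivity
  have h := Real.pow_div_factorial_le_exp (c * (1 + ‖x‖)) (by positivity) N
  have hfac : (0 : ℝ) < N.factorial := by exact_mod_cast N.factorial_pos
  rw [Real.norm_eq_abs, Real.abs_exp, Real.rpow_neg h1.le, Real.rpow_natCast,
    show -c * ‖x‖ = c - c * (1 + ‖x‖) by ring, Real.exp_sub, div_eq_mul_inv, mul_assoc]
  gcongr
  calc (Real.exp (c * (1 + ‖x‖)))⁻¹ ≤ ((c * (1 + ‖x‖)) ^ N / N.factorial)⁻¹ := by gcongr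
    _ = N.factorial / c ^ N * ((1 + ‖x‖) ^ N)⁻¹ := by
      rw [mul_pow]; field_simp

lemma memLp_exp_neg_mul_norm [NormedSpace ℝ E] [FiniteDimensional ℝ E]
    [MeasurableSpace E] [BorelSpace E] (μ : Measure E) [μ.IsAddHaarMeasure]
    {c q : ℝ} (hc : 0 < c) (hq : 0 < q) :
    MemLp (fun x : E => Real.exp (-c * ‖x‖)) (ENNReal.ofReal q) μ := by
  rw [← integrable_norm_rpow_iff (continuous_exp_neg_mul_norm c).aestronglyMeasurable
    (by simpa using hq) ENNReal.ofReal_ne_top]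
  refine (integrable_exp_neg_mul_norm_s11 μ (mul_pos hc hq)).congr (.of_forall fun x => ?_)
  simp only [Real.norm_eq_abs, Real.abs_exp]
  rw [ENNReal.toReal_ofReal hq.le, ← Real.exp_mul]
  ring_nf

lemma norm_le_sqrt_one_add_norm_sq (x : E) : ‖x‖ ≤ Real.sqrt (1 + ‖x‖ ^ 2) :=
  Real.le_sqrt_of_sq_le (by linarith)

lemma lintegral_le_of_forall_closedBall_le [MeasurableSpace E] (μ : Measure E)
    {f : E → ENNReal} {C : ENNReal}
    (h : ∀ k : ℕ, ∫⁻ x in Metric.closedBall (0 : E) (k + 1), f x ∂μ ≤ C) :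
    ∫⁻ x, f x ∂μ ≤ C := by
  have hU : ⋃ k : ℕ, Metric.closedBall (0 : E) (k + 1) = Set.univ := by
    refine Set.eq_univ_of_forall fun x => Set.mem_iUnion.2 ?_
    obtain ⟨k, hk⟩ := exists_nat_ge ‖x‖
    exact ⟨k, mem_closedBall_zero_iff.2 (by linarith)⟩
  rw [← setLIntegral_univ, ← hU, setLIntegral_iUnion_of_directed]
  · exact iSup_le h
  · refine Monotone.directed_le fun i j hij => Metric.closedBall_subset_closedBall ?_
    gcongr

variable [InnerProductSpace ℝ E]

lemma contDiff_sqrt_one_add_norm_sq {k : WithTop ℕ∞} :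
    ContDiff ℝ k fun x : E => Real.sqrt (1 + ‖x‖ ^ 2) :=
  (contDiff_const.add (contDiff_norm_sq ℝ)).sqrt fun x => by positivity

lemma norm_fderiv_sqrt_one_add_norm_sq_le (x : E) :
    ‖fderiv ℝ (fun y : E => Real.sqrt (1 + ‖y‖ ^ 2)) x‖ ≤ 1 := by
  have hs : 0 < Real.sqrt (1 + ‖x‖ ^ 2) := Real.sqrt_pos.2 (by positivity)
  have h := (((hasStrictFDerivAt_norm_sq x).hasFDerivAt).const_add 1).sqrt
    (by positivity : (1 + ‖x‖ ^ 2 : ℝ) ≠ 0)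
  rw [h.fderiv, norm_smul]
  have h2 : ‖(2 : ℕ) • innerSL ℝ x‖ ≤ 2 * ‖x‖ := by
    refine (norm_nsmul_le).trans ?_
    simp
  calc ‖1 / (2 * Real.sqrt (1 + ‖x‖ ^ 2))‖ * ‖(2 : ℕ) • innerSL ℝ x‖
      ≤ 1 / (2 * Real.sqrt (1 + ‖x‖ ^ 2)) * (2 * Real.sqrt (1 + ‖x‖ ^ 2)) := by
        rw [Real.norm_of_nonneg (by positivity)]
        gcongr
        exact h2.trans (by gcongr; exact norm_le_sqrt_one_add_norm_sq x)
    _ = 1 := by field_simp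

variable [FiniteDimensional ℝ E]

/-- Cutoffs equal to `1` on large balls, with uniformly bounded derivatives. -/
lemma exists_cutoff_norm_fderiv_le :
    ∃ K : ℝ, 0 ≤ K ∧ ∀ R : ℝ, 1 ≤ R → ∃ φ : E → ℝ, ContDiff ℝ 1 φ ∧ HasCompactSupport φ ∧
      (∀ x, 0 ≤ φ x) ∧ (∀ x, φ x ≤ 1) ∧ (∀ x, ‖x‖ ≤ R → φ x = 1) ∧
      ∀ x, ‖fderiv ℝ φ x‖ ≤ K := by
  let f : ContDiffBump (0 : E) := ⟨1, 2, zero_lt_one, one_lt_two⟩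
  have hf : ContDiff ℝ 1 f := f.contDiff
  obtain ⟨K, hK⟩ := (f.hasCompactSupport.fderiv (𝕜 := ℝ)).exists_bound_of_continuous
    (hf.continuous_fderiv one_ne_zero)
  refine ⟨K, (norm_nonneg _).trans (hK 0), fun R hR => ?_⟩
  have hR0 : 0 < R := by linarith
  refine ⟨fun x => f (R⁻¹ • x), hf.comp (contDiff_const_smul _), ?_, fun x => f.nonneg,
    fun x => f.le_one, fun x hx => ?_, fun x => ?_⟩
  · exact f.hasCompactSupport.comp_smul (inv_ne_zero hR0.ne')
  · refine f.one_of_mem_closedBall ?_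
    rw [mem_closedBall_zero_iff, norm_smul, norm_inv, Real.norm_of_nonneg hR0.le]
    exact (inv_mul_le_one₀ hR0).2 hx
  · rw [fderiv_comp_smul, norm_smul, norm_inv, Real.norm_of_nonneg hR0.le]
    calc R⁻¹ * ‖fderiv ℝ f (R⁻¹ • x)‖ ≤ 1 * K := by
          gcongr
          · exact inv_le_one_of_one_le₀ hR
          · exact hK _
      _ = K := one_mul K

/-- Compactly supported `C¹` weights that dominate `exp (a * ‖x‖)` on large balls, and which
together with their derivatives are uniformly controlled by `exp (a * ‖x‖)`. -/
lemma exists_compactly_supported_exp_weight {a : ℝ} (ha : 0 < a) :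
    ∃ K : ℝ, 0 ≤ K ∧ ∀ R : ℝ, 1 ≤ R → ∃ W : E → ℝ, ContDiff ℝ 1 W ∧ HasCompactSupport W ∧
      (∀ x, 0 ≤ W x) ∧ (∀ x, ‖x‖ ≤ R → Real.exp (a * ‖x‖) ≤ W x) ∧
      (∀ x, W x ≤ K * Real.exp (a * ‖x‖)) ∧
      ∀ x, ‖fderiv ℝ W x‖ ≤ K * Real.exp (a * ‖x‖) := by
  obtain ⟨K, hK0, hK⟩ := exists_cutoff_norm_fderiv_le (E := E)
  refine ⟨(1 + a + K) * Real.exp a, by positivity, fun R hR => ?_⟩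
  obtain ⟨φ, hφ, hφc, hφ0, hφ1, hφR, hφ'⟩ := hK R hR
  set s : E → ℝ := fun x => Real.sqrt (1 + ‖x‖ ^ 2) with hs
  have hsC : ContDiff ℝ 1 s := contDiff_sqrt_one_add_norm_sq
  have hwC : ContDiff ℝ 1 fun x => Real.exp (a * s x) := (contDiff_const.mul hsC).exp
  have hw_le (x : E) : Real.exp (a * s x) ≤ Real.exp a * Real.exp (a * ‖x‖) := by
    rw [← Real.exp_add]
    gcongr
    nlinarith [sqrt_one_add_norm_sq_le x]
  have hw' (x : E) : ‖fderiv ℝ (fun x => Real.exp (a * s x)) x‖ ≤ a * Real.exp (a * s x) := by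
    have h := (((hsC.differentiable one_ne_zero x).hasFDerivAt).const_mul a).exp
    rw [h.fderiv, norm_smul, norm_smul, Real.norm_of_nonneg (Real.exp_pos _).le,
      Real.norm_of_nonneg ha.le]
    have := norm_fderiv_sqrt_one_add_norm_sq_le x
    have h3 : 0 < Real.exp (a * s x) := Real.exp_pos _
    calc _ ≤ Real.exp (a * s x) * (a * 1) := by gcongr
      _ = _ := by ring
  refine ⟨fun x => φ x * Real.exp (a * s x), hφ.mul hwC, hφc.mul_right,
    fun x => mul_nonneg (hφ0 x) (Real.exp_pos _).le, fun x hx => ?_, fun x => ?_, fun x => ?_⟩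
  · simp only [hφR x hx, one_mul]
    gcongr
    exact norm_le_sqrt_one_add_norm_sq x
  · calc φ x * Real.exp (a * s x) ≤ (1 + a + K) * (Real.exp a * Real.exp (a * ‖x‖)) := by
          gcongr
          · linarith [hφ1 x]
          · exact hw_le x
      _ = _ := by ring
  · rw [fderiv_fun_mul (hφ.differentiable one_ne_zero x) (hwC.differentiable one_ne_zero x)]
    calc _ ≤ φ x * (a * Real.exp (a * s x)) + Real.exp (a * s x) * K := by
          refine (norm_add_le _ _).trans ?_
          rw [norm_smul, norm_smul, Real.norm_of_nonneg (hφ0 x),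
            Real.norm_of_nonneg (Real.exp_pos _).le]
          gcongr
          · exact hφ0 x
          · exact hw' x
          · exact hφ' x
      _ ≤ 1 * (a * Real.exp (a * s x)) + Real.exp (a * s x) * K := by
          gcongr
          exact hφ1 x
      _ = (a + K) * Real.exp (a * s x) := by ring
      _ ≤ (1 + a + K) * (Real.exp a * Real.exp (a * ‖x‖)) := by
          gcongr
          · linarith
          · exact hw_le x
      _ = _ := by ring

variable [MeasurableSpace E] [BorelSpace E] (μ : Measure E) [μ.IsAddHaarMeasure]

lemma integral_weight_mul_fderiv_sq {u W : E → ℝ} (hu : ContDiff ℝ 2 u) (hW : ContDiff ℝ 1 W)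
    (hWc : HasCompactSupport W) (v : E) :
    ∫ x, W x * fderiv ℝ u x v ^ 2 ∂μ =
      -∫ x, (W x * fderiv ℝ (fun y => fderiv ℝ u y v) x v +
        fderiv ℝ W x v * fderiv ℝ u x v) * u x ∂μ := by
  have hf : ContDiff ℝ 1 fun y => fderiv ℝ u y v :=
    (hu.fderiv_right (by norm_num)).clm_apply contDiff_const
  have hu' : ContDiff ℝ 1 u := hu.of_le (by norm_num)
  set f : E → ℝ := fun y => fderiv ℝ u y v with hf_def
  have hWf : ContDiff ℝ 1 fun x => W x * f x := hW.mul hf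
  have hWfc : HasCompactSupport fun x => W x * f x := hWc.mul_right
  have hderiv (x : E) : fderiv ℝ (fun x => W x * f x) x v =
      W x * fderiv ℝ f x v + fderiv ℝ W x v * f x := by
    rw [fderiv_fun_mul (hW.differentiable one_ne_zero x) (hf.differentiable one_ne_zero x)]
    simp [mul_comm]
  have hD : Continuous fun x => fderiv ℝ (fun x => W x * f x) x v :=
    (hWf.continuous_fderiv one_ne_zero).clm_apply continuous_const
  have key := integral_mul_fderiv_eq_neg_fderiv_mul_of_integrable (μ := μ) (v := v)
    (f := fun x => W x * f x) (g := u)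
    ((hD.mul hu.continuous).integrable_of_hasCompactSupport (hWfc.fderiv_apply ℝ v).mul_right)
    ((hWf.continuous.mul hf.continuous).integrable_of_hasCompactSupport hWfc.mul_right)
    ((hWf.continuous.mul hu.continuous).integrable_of_hasCompactSupport hWfc.mul_right)
    (fun x _ => hWf.differentiable one_ne_zero x) (fun x _ => hu'.differentiable one_ne_zero x)
  simp only [hderiv] at key
  rw [← key]
  congr 1 with x
  simp only [hf_def]
  ring

lemma lintegral_weight_mul_fderiv_sq_le {u W G : E → ℝ} (hu : ContDiff ℝ 2 u)
    (hW : ContDiff ℝ 1 W) (hWc : HasCompactSupport W) (hW0 : ∀ x, 0 ≤ W x) (v : E)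
    (hG : Continuous G) (hWG : ∀ x, W x * |u x| ≤ G x)
    (hWG' : ∀ x, |fderiv ℝ W x v| * |u x| ≤ G x)
    {p q : ENNReal} [hpq : ENNReal.HolderConjugate p q] :
    ∫⁻ x, ENNReal.ofReal (W x * fderiv ℝ u x v ^ 2) ∂μ ≤
      eLpNorm (fun x => fderiv ℝ (fun y => fderiv ℝ u y v) x v) p μ * eLpNorm G q μ +
        eLpNorm (fun x => fderiv ℝ u x v) p μ * eLpNorm G q μ := by
  have hf : ContDiff ℝ 1 fun y => fderiv ℝ u y v :=
    (hu.fderiv_right (by norm_num)).clm_apply contDiff_const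
  have hh : Continuous fun x => fderiv ℝ (fun y => fderiv ℝ u y v) x v :=
    (hf.continuous_fderiv one_ne_zero).clm_apply continuous_const
  have holder {g : E → ℝ} (hg : Continuous g) :
      ∫⁻ x, ‖g x‖ₑ * ‖G x‖ₑ ∂μ ≤ eLpNorm g p μ * eLpNorm G q μ := by
    have := eLpNorm_smul_le_mul_eLpNorm (r := 1) (p := p) (q := q) (μ := μ)
      hG.aestronglyMeasurable hg.aestronglyMeasurable
    simpa [eLpNorm_one_eq_lintegral_enorm, enorm_mul] using this
  have hint : Integrable (fun x => W x * fderiv ℝ u x v ^ 2) μ :=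
    (hW.continuous.mul (hf.continuous.pow 2)).integrable_of_hasCompactSupport hWc.mul_right
  rw [← ofReal_integral_eq_lintegral_ofReal hint
    (.of_forall fun x => mul_nonneg (hW0 x) (sq_nonneg _)),
    integral_weight_mul_fderiv_sq μ hu hW hWc v]
  calc _ ≤ ENNReal.ofReal ‖∫ x, (W x * fderiv ℝ (fun y => fderiv ℝ u y v) x v +
        fderiv ℝ W x v * fderiv ℝ u x v) * u x ∂μ‖ :=
        ENNReal.ofReal_le_ofReal (neg_le_abs _)
    _ ≤ ∫⁻ x, ‖(W x * fderiv ℝ (fun y => fderiv ℝ u y v) x v +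
        fderiv ℝ W x v * fderiv ℝ u x v) * u x‖ₑ ∂μ := by
        rw [ofReal_norm]
        exact enorm_integral_le_lintegral_enorm _
    _ ≤ ∫⁻ x, (‖fderiv ℝ (fun y => fderiv ℝ u y v) x v‖ₑ * ‖G x‖ₑ +
        ‖fderiv ℝ u x v‖ₑ * ‖G x‖ₑ) ∂μ := by
        refine lintegral_mono fun x => ?_
        simp only [← ofReal_norm]
        have hG0 : 0 ≤ G x := (mul_nonneg (hW0 x) (abs_nonneg _)).trans (hWG x)
        rw [← ENNReal.ofReal_mul (norm_nonneg _), ← ENNReal.ofReal_mul (norm_nonneg _),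
          ← ENNReal.ofReal_add (by positivity) (by positivity), Real.norm_of_nonneg hG0]
        refine ENNReal.ofReal_le_ofReal ?_
        set b := fderiv ℝ (fun y => fderiv ℝ u y v) x v
        set c := fderiv ℝ u x v
        rw [norm_mul]
        simp only [Real.norm_eq_abs]
        calc _ ≤ (|W x * b| + |fderiv ℝ W x v * c|) * |u x| := by
              gcongr
              exact abs_add_le _ _
          _ = |b| * (W x * |u x|) + |c| * (|fderiv ℝ W x v| * |u x|) := by
              rw [abs_mul, abs_mul, abs_of_nonneg (hW0 x)]
              ring
          _ ≤ _ := by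
              gcongr
              · exact hWG x
              · exact hWG' x
    _ = _ := lintegral_add_left (hh.enorm.measurable.mul hG.enorm.measurable) _
    _ ≤ _ := add_le_add (holder hh) (holder hf.continuous)

lemma exists_lintegral_exp_mul_fderiv_sq_le {p lam Lam M : ℝ} (hp : 1 < p) (hlam : 0 < lam)
    (hM : 0 < M) :
    ∃ C : ℝ, 0 < C ∧ ∀ (u : E → ℝ) (v : E), ‖v‖ ≤ 1 → ContDiff ℝ 2 u →
      (∀ x, |u x| ≤ Lam * Real.exp (-lam * ‖x‖)) →
      eLpNorm (fun x => fderiv ℝ u x v) (ENNReal.ofReal p) μ ≤ ENNReal.ofReal M →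
      eLpNorm (fun x => fderiv ℝ (fun y => fderiv ℝ u y v) x v) (ENNReal.ofReal p) μ ≤
        ENNReal.ofReal M →
      ∫⁻ x, ENNReal.ofReal (Real.exp (lam * ‖x‖ / 2) * fderiv ℝ u x v ^ 2) ∂μ ≤
        ENNReal.ofReal C := by
  obtain ⟨K, hK0, hK⟩ := exists_compactly_supported_exp_weight (E := E) (half_pos hlam)
  have hpq : p.HolderConjugate p.conjExponent := .conjExponent hp
  have : ENNReal.HolderConjugate (ENNReal.ofReal p) (ENNReal.ofReal p.conjExponent) :=
    hpq.ennrealOfReal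
  set G : E → ℝ := fun x => K * Lam * Real.exp (-(lam / 2) * ‖x‖) with hG_def
  have hG : Continuous G := by fun_prop
  have hGq : MemLp G (ENNReal.ofReal p.conjExponent) μ :=
    (memLp_exp_neg_mul_norm μ (half_pos hlam) hpq.symm.pos).const_mul _
  set Q : ℝ := (eLpNorm G (ENNReal.ofReal p.conjExponent) μ).toReal with hQ
  have hQG : eLpNorm G (ENNReal.ofReal p.conjExponent) μ = ENNReal.ofReal Q :=
    (ENNReal.ofReal_toReal hGq.2.ne).symm
  have hQ0 : 0 ≤ Q := ENNReal.toReal_nonneg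
  refine ⟨M * Q + M * Q + 1, by positivity, fun u v hv hu hdecay h1 h2 => ?_⟩
  refine lintegral_le_of_forall_closedBall_le μ fun k => ?_
  obtain ⟨W, hW, hWc, hW0, hWR, hWK, hWK'⟩ := hK (k + 1) (by simp)
  have hGle {w : ℝ} (x : E) (hw : w ≤ K * Real.exp (lam / 2 * ‖x‖)) : w * |u x| ≤ G x := by
    calc w * |u x| ≤ K * Real.exp (lam / 2 * ‖x‖) * (Lam * Real.exp (-lam * ‖x‖)) := by
          gcongr
          exact hdecay x
      _ = K * Lam * (Real.exp (lam / 2 * ‖x‖) * Real.exp (-lam * ‖x‖)) := by ring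
      _ = G x := by
          rw [← Real.exp_add, hG_def]
          ring_nf
  have hW'v (x : E) : |fderiv ℝ W x v| ≤ K * Real.exp (lam / 2 * ‖x‖) := by
    refine ((fderiv ℝ W x).le_opNorm v).trans ((mul_le_of_le_one_right (norm_nonneg _) hv).trans ?_)
    exact hWK' x
  calc _ ≤ ∫⁻ x in Metric.closedBall (0 : E) (k + 1),
        ENNReal.ofReal (W x * fderiv ℝ u x v ^ 2) ∂μ := by
        refine setLIntegral_mono' Metric.isClosed_closedBall.measurableSet fun x hx => ?_
        refine ENNReal.ofReal_le_ofReal ?_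
        gcongr
        have := hWR x (mem_closedBall_zero_iff.1 hx)
        rwa [div_mul_eq_mul_div] at this
    _ ≤ ∫⁻ x, ENNReal.ofReal (W x * fderiv ℝ u x v ^ 2) ∂μ := setLIntegral_le_lintegral _ _
    _ ≤ _ := lintegral_weight_mul_fderiv_sq_le μ hu hW hWc hW0 v hG
        (fun x => hGle x (hWK x)) (fun x => hGle x (hW'v x)) (p := ENNReal.ofReal p)
        (q := ENNReal.ofReal p.conjExponent)
    _ ≤ ENNReal.ofReal M * ENNReal.ofReal Q + ENNReal.ofReal M * ENNReal.ofReal Q := by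
        rw [hQG]
        gcongr
    _ = ENNReal.ofReal (M * Q + M * Q) := by
        rw [← ENNReal.ofReal_mul hM.le, ← ENNReal.ofReal_add (by positivity) (by positivity)]
    _ ≤ _ := ENNReal.ofReal_le_ofReal (by linarith)

end WeightedGradient

/-- Weighted `L²` decay of the gradient: if `|u| ≤ Λ e^{−λ|x|}` and all first and second
coordinate partial derivatives of `u` have `Lᵖ` norm at most `M` (`1 < p < ∞`), then
`∫ e^{λ|x|/2} |∇u|² dx ≤ C` with `C = C(n, p, λ, Λ, M)`. -/
theorem weighted_L2_gradient_decay (n : ℕ) (hn : 1 ≤ n) (p : ℝ) (hp : 1 < p)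
    (lam Lam M : ℝ) (hlam : 0 < lam) (hLam : 0 < Lam) (hM : 0 < M) :
    ∃ C > (0 : ℝ), ∀ u : EuclideanSpace ℝ (Fin n) → ℝ,
      ContDiff ℝ 2 u →
      (∀ x : EuclideanSpace ℝ (Fin n), |u x| ≤ Lam * Real.exp (-lam * ‖x‖)) →
      (∀ j : Fin n,
        eLpNorm (fun x => fderiv ℝ u x (EuclideanSpace.single j 1))
            (ENNReal.ofReal p) volume ≤ ENNReal.ofReal M ∧
        eLpNorm (fun x =>
            fderiv ℝ (fun y => fderiv ℝ u y (EuclideanSpace.single j 1)) x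
              (EuclideanSpace.single j 1)) (ENNReal.ofReal p) volume ≤ ENNReal.ofReal M) →
      ∫⁻ x, ENNReal.ofReal (Real.exp (lam * ‖x‖ / 2) *
          ∑ j : Fin n, (fderiv ℝ u x (EuclideanSpace.single j 1)) ^ 2) ≤
        ENNReal.ofReal C := by
  obtain ⟨C, hC, h⟩ := exists_lintegral_exp_mul_fderiv_sq_le
    (volume : Measure (EuclideanSpace ℝ (Fin n))) hp hlam hM
  have hn' : (0 : ℝ) < n := by exact_mod_cast hn
  refine ⟨n * C, by positivity, fun u hu hdecay hbd => ?_⟩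
  have hcont (j : Fin n) : Continuous fun x => fderiv ℝ u x (EuclideanSpace.single j 1) :=
    (hu.continuous_fderiv two_ne_zero).clm_apply continuous_const
  calc _ = ∫⁻ x, ∑ j : Fin n, ENNReal.ofReal (Real.exp (lam * ‖x‖ / 2) *
        fderiv ℝ u x (EuclideanSpace.single j 1) ^ 2) := by
        congr 1 with x
        rw [Finset.mul_sum, ENNReal.ofReal_sum_of_nonneg fun j _ => by positivity]
    _ = ∑ j : Fin n, ∫⁻ x, ENNReal.ofReal (Real.exp (lam * ‖x‖ / 2) *
        fderiv ℝ u x (EuclideanSpace.single j 1) ^ 2) := by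
        refine lintegral_finsetSum _ fun j _ => ?_
        have := hcont j
        exact (ENNReal.continuous_ofReal.comp (by fun_prop)).measurable
    _ ≤ ∑ _j : Fin n, ENNReal.ofReal C :=
        Finset.sum_le_sum fun j _ => h u _ (by simp) hu hdecay (hbd j).1 (hbd j).2
    _ = ENNReal.ofReal (n * C) := by
        simp [ENNReal.ofReal_mul hn'.le]
end
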